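/- arXiv:1505.00647 — 4 statements merged into one kernel-verified Lean document; each statement's English description precedes it below -/
import Mathlib

section
/- Let 0 < K₁ < K₂ be real numbers. Let m be a positive integer which is squarefree, divisible by 3, and such that every prime divisor of m/3 is congruent to 5 modulo 6. Let ε_m, δ_m be real numbers satisfying 0 ≤ ε_m < δ_m ≤ 1, K₁ ≥ (8δ_m³ + 1/36)m³ + 3m/4, and K₂ ≤ (8ε_m³ + 1/18)m³ + m/2. Let N be an odd integer with K₁ ≤ N ≤ K₂, and suppose N ≡ 8t³ (mod m) for some integer t with ε_m·m ≤ t < δ_m·m. Then N is the sum of seven non-negative cubes. -/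
/-- Davenport-Cassels descent: if `n t²` is a sum of three integer squares for some `t ≠ 0`,
then so is `n`. -/
theorem sum_three_squares_of_mul_sq {n : ℤ} {t : ℕ} (ht : 0 < t) {x y z : ℤ}
    (h : x ^ 2 + y ^ 2 + z ^ 2 = n * (t : ℤ) ^ 2) :
    ∃ a b c : ℤ, a ^ 2 + b ^ 2 + c ^ 2 = n := by
  induction t using Nat.strong_induction_on generalizing x y z with
  | _ t ih =>
    have htpos : (0 : ℤ) < t := by exact_mod_cast ht
    have nearest (w : ℤ) : ∃ a : ℤ, 4 * (t * a - w) ^ 2 ≤ (t : ℤ) ^ 2 := by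
      refine ⟨(2 * w + t) / (2 * t), ?_⟩
      have h1 := Int.mul_ediv_add_emod (2 * w + t) (2 * t)
      have h2 := Int.emod_nonneg (2 * w + t) (by positivity : (2 * t : ℤ) ≠ 0)
      have h3 := Int.emod_lt_of_pos (2 * w + t) (by positivity : (0 : ℤ) < 2 * t)
      nlinarith
    obtain ⟨a, ha⟩ := nearest x
    obtain ⟨b, hb⟩ := nearest y
    obtain ⟨c, hc⟩ := nearest z
    set A := a ^ 2 + b ^ 2 + c ^ 2 - n with hA
    set B := 2 * (n * t - (x * a + y * b + z * c)) with hB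
    have key : (t : ℤ) * (A * t + B) = (t * a - x) ^ 2 + (t * b - y) ^ 2 + (t * c - z) ^ 2 := by
      rw [hA, hB]; linear_combination -h
    have hnonneg : 0 ≤ A * t + B := by
      by_contra! hneg
      nlinarith [sq_nonneg (t * a - x), sq_nonneg (t * b - y), sq_nonneg (t * c - z)]
    have hlt : A * t + B < t := by
      by_contra! hge
      nlinarith
    obtain ⟨s, hs⟩ := Int.eq_ofNat_of_zero_le hnonneg
    rcases Nat.eq_zero_or_pos s with rfl | hspos
    · rw [hs, Nat.cast_zero, mul_zero] at key
      have hx : (t * a - x) ^ 2 = 0 := by nlinarith [sq_nonneg (t * b - y), sq_nonneg (t * c - z)]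
      have hy : (t * b - y) ^ 2 = 0 := by nlinarith [sq_nonneg (t * a - x), sq_nonneg (t * c - z)]
      have hz : (t * c - z) ^ 2 = 0 := by nlinarith [sq_nonneg (t * a - x), sq_nonneg (t * b - y)]
      rw [sq_eq_zero_iff, sub_eq_zero] at hx hy hz
      refine ⟨a, b, c, mul_right_cancel₀ (pow_ne_zero 2 htpos.ne') ?_⟩
      rw [← h, ← hx, ← hy, ← hz]; ring
    · refine ih s (by omega) hspos (x := A * x + B * a) (y := A * y + B * b)
        (z := A * z + B * c) ?_
      rw [← hs]
      linear_combination A ^ 2 * h + B ^ 2 * hA.symm - A * B * hB.symm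

/-- If `n` and `q` are coprime nonsquares, `-q` is a square modulo `n` and `n` is a square
modulo `q`, then `z² + q s² = n t²` has a nontrivial integer solution. -/
theorem exists_sq_add_mul_sq_eq_mul_sq {n q : ℕ} (hn : 0 < n) (hq : 0 < q)
    (hcop : Nat.Coprime n q) (hnsq : ¬ IsSquare n) (hqsq : ¬ IsSquare q)
    {u v : ℤ} (hu : (n : ℤ) ∣ u ^ 2 + q) (hv : (q : ℤ) ∣ v ^ 2 - n) :
    ∃ z s t : ℤ, t ≠ 0 ∧ z ^ 2 + q * s ^ 2 = n * t ^ 2 := by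
  have : NeZero n := ⟨hn.ne'⟩
  have : NeZero q := ⟨hq.ne'⟩
  let f : ℕ × ℕ × ℕ → ZMod n × ZMod q := fun w =>
    ((w.1 : ZMod n) - (u : ZMod n) * w.2.1, (w.1 : ZMod q) - (v : ZMod q) * w.2.2)
  let box := Finset.range ((q * n).sqrt + 1) ×ˢ Finset.range (n.sqrt + 1) ×ˢ
    Finset.range (q.sqrt + 1)
  have hcard : (Finset.univ : Finset (ZMod n × ZMod q)).card < box.card := by
    simp only [box, Finset.card_product, Finset.card_range, Finset.card_univ, Fintype.card_prod,
      ZMod.card]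
    have h1 := Nat.lt_succ_sqrt (q * n)
    have h2 := Nat.lt_succ_sqrt n
    have h3 := Nat.lt_succ_sqrt q
    refine lt_of_mul_self_lt_mul_self₀ (Nat.zero_le _) ?_
    calc n * q * (n * q) = q * n * (n * q) := by ring
      _ < ((q * n).sqrt + 1) * ((q * n).sqrt + 1) *
          ((n.sqrt + 1) * (n.sqrt + 1) * ((q.sqrt + 1) * (q.sqrt + 1))) :=
        Nat.mul_lt_mul'' h1 (Nat.mul_lt_mul'' h2 h3)
      _ = _ := by ring
  obtain ⟨⟨z₁, s₁, t₁⟩, h₁, ⟨z₂, s₂, t₂⟩, h₂, hne, hf⟩ :=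
    Finset.exists_ne_map_eq_of_card_lt_of_maps_to hcard (f := f) (fun _ _ => Finset.mem_univ _)
  simp only [box, Finset.mem_product, Finset.mem_range, Nat.lt_succ_iff] at h₁ h₂
  simp only [f, Prod.mk.injEq] at hf
  have sq_sub_le {a b m : ℕ} (ha : a ≤ m.sqrt) (hb : b ≤ m.sqrt) : ((a : ℤ) - b) ^ 2 ≤ m := by
    have : ((m.sqrt : ℕ) : ℤ) * m.sqrt ≤ m := by exact_mod_cast Nat.sqrt_le m
    have : |(a : ℤ) - b| ≤ m.sqrt := by rw [abs_le]; omega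
    have := sq_abs ((a : ℤ) - b)
    nlinarith [abs_nonneg ((a : ℤ) - b)]
  have hz := sq_sub_le h₁.1 h₂.1
  have hs := sq_sub_le h₁.2.1 h₂.2.1
  have ht := sq_sub_le h₁.2.2 h₂.2.2
  have hzs : (n : ℤ) ∣ (z₁ - z₂ : ℤ) - u * (s₁ - s₂) := by
    rw [← ZMod.intCast_zmod_eq_zero_iff_dvd]
    push_cast
    linear_combination hf.1
  have hzt : (q : ℤ) ∣ (z₁ - z₂ : ℤ) - v * (t₁ - t₂) := by
    rw [← ZMod.intCast_zmod_eq_zero_iff_dvd]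
    push_cast
    linear_combination hf.2
  have hne' : (z₁ - z₂ : ℤ) ≠ 0 ∨ (s₁ - s₂ : ℤ) ≠ 0 ∨ (t₁ - t₂ : ℤ) ≠ 0 := by
    by_contra! h
    apply hne
    simp only [Prod.mk.injEq]
    omega
  generalize (z₁ - z₂ : ℤ) = z at *
  generalize (s₁ - s₂ : ℤ) = s at *
  generalize (t₁ - t₂ : ℤ) = t at *
  push_cast at hz
  have hn' : (0 : ℤ) < n := by exact_mod_cast hn
  have hq' : (0 : ℤ) < q := by exact_mod_cast hq
  have not_sq {m : ℕ} (hm : ¬ IsSquare m) (w : ℤ) : w ^ 2 ≠ m := fun h =>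
    hm ⟨w.natAbs, by zify; rw [← sq, sq_abs, h]⟩
  have hs' : s ^ 2 < n := lt_of_le_of_ne hs (not_sq hnsq s)
  have ht' : t ^ 2 < q := lt_of_le_of_ne ht (not_sq hqsq t)
  have hdvd : (n : ℤ) * q ∣ z ^ 2 + q * s ^ 2 - n * t ^ 2 := by
    refine IsCoprime.mul_dvd (Nat.isCoprime_iff_coprime.mpr hcop) ?_ ?_
    · obtain ⟨a, ha⟩ := hzs
      obtain ⟨b, hb⟩ := hu
      exact ⟨a * (z + u * s) + b * s ^ 2 - t ^ 2, by
        linear_combination (z + u * s) * ha + s ^ 2 * hb⟩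
    · obtain ⟨a, ha⟩ := hzt
      obtain ⟨b, hb⟩ := hv
      exact ⟨a * (z + v * t) + b * t ^ 2 + s ^ 2, by
        linear_combination (z + v * t) * ha + t ^ 2 * hb⟩
  obtain ⟨k, hk⟩ := hdvd
  have hnq : (0 : ℤ) < n * q := by positivity
  have hk_lt : k < 2 := by
    by_contra! h
    nlinarith [mul_nonneg hn'.le (sq_nonneg t)]
  have hk_gt : -1 < k := by
    by_contra! h
    nlinarith [mul_nonneg hq'.le (sq_nonneg s), sq_nonneg z]
  have nontrivial_right {z s t : ℤ} (h : z ^ 2 + q * s ^ 2 = n * t ^ 2) (hzs : z ≠ 0 ∨ s ≠ 0) :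
      t ≠ 0 := by
    rintro rfl
    rcases hzs with h0 | h0
    · nlinarith [mul_nonneg hq'.le (sq_nonneg s), pow_pos (abs_pos.mpr h0) 2, sq_abs z]
    · nlinarith [mul_pos hq' (pow_pos (abs_pos.mpr h0) 2), sq_abs s, sq_nonneg z]
  obtain rfl | rfl : k = 0 ∨ k = 1 := by omega
  · have heq : z ^ 2 + q * s ^ 2 = n * t ^ 2 := by linarith
    exact ⟨z, s, t, fun h0 => nontrivial_right heq (by tauto) h0, heq⟩
  · have heq : (z ^ 2 - n * q) ^ 2 + q * (s * z + n * t) ^ 2 = n * (t * z + q * s) ^ 2 := by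
      linear_combination (z ^ 2 - n * q) * hk
    refine ⟨z ^ 2 - n * q, s * z + n * t, t * z + q * s, nontrivial_right heq ?_, heq⟩
    refine Or.inl fun h0 => hnsq ?_
    have hz0 : n * q = z.natAbs ^ 2 := by
      zify
      rw [sq_abs]
      linarith
    obtain ⟨w, hw⟩ := exists_eq_pow_of_mul_eq_pow (Nat.isUnit_iff.mpr hcop) hz0
    exact ⟨w, by rw [hw, sq]⟩

/-- A natural number congruent to `3` modulo `8` is a sum of three squares. -/
theorem sum_three_squares_of_mod_eight_eq_three {n : ℕ} (hn : n % 8 = 3) :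
    ∃ a b c : ℤ, a ^ 2 + b ^ 2 + c ^ 2 = n := by
  have hnpos : 0 < n := by omega
  have hcop : Nat.Coprime ((n - 1) / 2) (4 * n) := by
    refine Nat.Coprime.mul_right ?_ ?_
    · exact Nat.Coprime.pow_right 2 (Nat.coprime_two_right.mpr (Nat.odd_iff.mpr (by omega)))
    · rw [← Nat.isCoprime_iff_coprime]
      exact ⟨-2, 1, by omega⟩
  obtain ⟨p, -, hp, hpmod⟩ := Nat.forall_exists_prime_gt_and_modEq 0 (by omega) hcop
  have : Fact p.Prime := ⟨hp⟩
  have hp4 : p % 4 = 1 := by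
    have : p % 4 = (n - 1) / 2 % 4 := hpmod.of_mul_right n
    omega
  have hpn : (n : ℤ) ∣ 2 * p + 1 := by
    have h := (Nat.modEq_iff_dvd.mp (hpmod.of_mul_left 4))
    have h2 : (2 : ℤ) * p + 1 = n - 2 * (((n - 1) / 2 : ℕ) - p) := by omega
    rw [h2]
    exact dvd_sub dvd_rfl (h.mul_left 2)
  have hnodd : Odd n := Nat.odd_iff.mpr (by omega)
  have hjac : jacobiSym p n = 1 := by
    have h1 : jacobiSym (2 * p) n = jacobiSym (-1) n :=
      jacobiSym.mod_left' (Int.emod_eq_emod_iff_emod_sub_eq_zero.mpr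
        (Int.emod_eq_zero_of_dvd (by simpa using hpn)))
    have h2 : ZMod.χ₈ n = -1 := by
      rw [ZMod.χ₈_nat_eq_if_mod_eight]
      simp [hn, show n % 2 ≠ 0 by omega]
    have h4 : ZMod.χ₄ n = -1 := ZMod.χ₄_nat_three_mod_four (by omega)
    rw [jacobiSym.mul_left, jacobiSym.at_two hnodd, jacobiSym.at_neg_one hnodd, h2, h4] at h1
    linarith
  have hjac' : jacobiSym (n : ℤ) p = 1 := by
    rw [← jacobiSym.quadratic_reciprocity_one_mod_four hp4 hnodd, hjac]
  obtain ⟨v, hvodd, hv⟩ : ∃ v : ℤ, Odd v ∧ (p : ℤ) ∣ v ^ 2 - n := by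
    obtain ⟨w, hw⟩ := ZMod.isSquare_of_jacobiSym_eq_one hjac'
    obtain ⟨c, rfl⟩ := ZMod.intCast_surjective w
    have hc : (p : ℤ) ∣ c ^ 2 - n := by
      rw [← ZMod.intCast_zmod_eq_zero_iff_dvd]
      push_cast at hw ⊢
      rw [hw]; ring
    rcases Int.even_or_odd c with hce | hco
    · have hpodd : Odd (p : ℤ) := by
        rw [Int.odd_iff]; omega
      refine ⟨c + p, hce.add_odd hpodd, ?_⟩
      have : (c + p : ℤ) ^ 2 - n = (c ^ 2 - n) + p * (2 * c + p) := by ring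
      rw [this]
      exact dvd_add hc (dvd_mul_right _ _)
    · exact ⟨c, hco, hc⟩
  have hdvd : ((2 * p : ℕ) : ℤ) ∣ v ^ 2 - n := by
    push_cast
    refine IsCoprime.mul_dvd ?_ ?_ hv
    · rw [Int.isCoprime_iff_gcd_eq_one]
      exact Nat.coprime_two_left.mpr (Nat.odd_iff.mpr (by omega))
    · have hnodd' : Odd (n : ℤ) := by exact_mod_cast hnodd
      exact (hvodd.pow.sub_odd hnodd').two_dvd
  have hcop_two_mul : Nat.Coprime n (2 * p) := by
    obtain ⟨k, hk⟩ := hpn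
    rw [← Nat.isCoprime_iff_coprime]
    exact ⟨k, -1, by push_cast; linarith⟩
  have not_isSquare_of_mod_four {k : ℕ} (hk : k % 4 = 2 ∨ k % 4 = 3) : ¬ IsSquare k := by
    rintro ⟨w, rfl⟩
    have : w % 4 < 4 := Nat.mod_lt _ (by norm_num)
    rw [Nat.mul_mod] at hk
    interval_cases w % 4 <;> omega
  obtain ⟨z, s, t, ht, h⟩ := exists_sq_add_mul_sq_eq_mul_sq (n := n) (q := 2 * p) (u := 1) (v := v)
    hnpos (by have := hp.pos; omega) hcop_two_mul
    (not_isSquare_of_mod_four (Or.inr (by omega))) (not_isSquare_of_mod_four (Or.inl (by omega)))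
    (by push_cast; rwa [add_comm]) hdvd
  obtain ⟨a, b, hab⟩ := Nat.Prime.sq_add_sq (p := p) (by omega)
  refine sum_three_squares_of_mul_sq (t := t.natAbs) (Int.natAbs_pos.mpr ht)
    (x := z) (y := (a + b) * s) (z := (a - b) * s) ?_
  have hab' : (a : ℤ) ^ 2 + b ^ 2 = p := by exact_mod_cast hab
  push_cast at h
  rw [Int.natCast_natAbs, sq_abs]
  linear_combination h + 2 * s ^ 2 * hab'

theorem exists_four_mul_sum_two_cubes {r a : ℤ} (hr : Odd r) (ha : Odd a) (har : |a| ≤ r) :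
    ∃ u v : ℕ, 4 * ((u : ℤ) ^ 3 + (v : ℤ) ^ 3) = r ^ 3 + 3 * r * a ^ 2 := by
  obtain ⟨hl, hu⟩ := abs_le.mp har
  obtain ⟨c, hc⟩ := hr.add_odd ha
  obtain ⟨u, rfl⟩ := Int.eq_ofNat_of_zero_le (show 0 ≤ c by omega)
  obtain ⟨v, hv⟩ := Int.eq_ofNat_of_zero_le (show 0 ≤ r - u by omega)
  refine ⟨u, v, ?_⟩
  rw [← hv, show a = 2 * u - r by linarith]
  ring

theorem odd_of_sum_three_squares {a b c : ℤ} (h : (a ^ 2 + b ^ 2 + c ^ 2) % 4 = 3) : Odd a := by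
  rw [← Int.not_even_iff_odd]
  intro ha
  have ha' := Int.even_iff.mp ha
  rcases Int.emod_two_eq_zero_or_one b with hb | hb <;>
  rcases Int.emod_two_eq_zero_or_one c with hc | hc <;>
  · rw [← Int.mul_ediv_add_emod a 2, ← Int.mul_ediv_add_emod b 2, ← Int.mul_ediv_add_emod c 2,
      ha', hb, hc] at h
    ring_nf at h
    omega

/-- If `r` and `q` are odd and `r² < 4 q ≤ 2 r² + 2`, then writing `4 q - r²` as a sum of three
squares exhibits `3 r q` as a sum of six nonnegative cubes. -/
theorem exists_sum_six_cubes {r q : ℤ} (hr : Odd r) (hq : Odd q) (hr0 : 0 < r)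
    (hlb : r ^ 2 < 4 * q) (hub : 4 * q ≤ 2 * r ^ 2 + 2) :
    ∃ a b c d e f : ℕ, 3 * r * q = (a : ℤ) ^ 3 + (b : ℤ) ^ 3 + (c : ℤ) ^ 3 + (d : ℤ) ^ 3
        + (e : ℤ) ^ 3 + (f : ℤ) ^ 3 := by
  obtain ⟨n, hn⟩ := Int.eq_ofNat_of_zero_le (show 0 ≤ 4 * q - r ^ 2 by linarith)
  have hr8 := Int.eight_dvd_sq_sub_one_of_odd hr
  obtain ⟨k, rfl⟩ := hq
  obtain ⟨x, y, z, h⟩ := sum_three_squares_of_mod_eight_eq_three (n := n) (by omega)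
  have hx : Odd x := odd_of_sum_three_squares (b := y) (c := z) (by omega)
  have hy : Odd y := odd_of_sum_three_squares (b := x) (c := z) (by omega)
  have hz : Odd z := odd_of_sum_three_squares (b := x) (c := y) (by omega)
  have one_le_sq {w : ℤ} (hw : Odd w) : 1 ≤ w ^ 2 := by
    have : w ≠ 0 := by rintro rfl; simp at hw
    have : 0 < w ^ 2 := by positivity
    omega
  have hx1 := one_le_sq hx
  have hy1 := one_le_sq hy
  have hz1 := one_le_sq hz
  obtain ⟨a, b, hab⟩ := exists_four_mul_sum_two_cubes hr hx
    (abs_le_of_sq_le_sq (by linarith) hr0.le)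
  obtain ⟨c, d, hcd⟩ := exists_four_mul_sum_two_cubes hr hy
    (abs_le_of_sq_le_sq (by linarith) hr0.le)
  obtain ⟨e, f, hef⟩ := exists_four_mul_sum_two_cubes hr hz
    (abs_le_of_sq_le_sq (by linarith) hr0.le)
  refine ⟨a, b, c, d, e, f, mul_left_cancel₀ (four_ne_zero : (4 : ℤ) ≠ 0) ?_⟩
  linear_combination 3 * r * hn - 3 * r * h - hab - hcd - hef

/-- Modified version of Watson's lemma: a criterion for an odd integer
`K₁ ≤ N ≤ K₂` to be a sum of seven non-negative cubes. -/
theorem sum_seven_cubes_of_cuberoot_in_interval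
    (K₁ K₂ : ℝ) (hK₁pos : 0 < K₁) (hK₁K₂ : K₁ < K₂)
    (m : ℕ) (hmpos : 0 < m) (hsf : Squarefree m) (h3 : 3 ∣ m)
    (hp : ∀ p : ℕ, p.Prime → p ∣ m / 3 → p % 6 = 5)
    (ε δ : ℝ) (hε : 0 ≤ ε) (hεδ : ε < δ) (hδ : δ ≤ 1)
    (hK₁ : (8 * δ ^ 3 + 1 / 36) * (m : ℝ) ^ 3 + 3 * m / 4 ≤ K₁)
    (hK₂ : K₂ ≤ (8 * ε ^ 3 + 1 / 18) * (m : ℝ) ^ 3 + m / 2)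
    (N : ℤ) (hodd : Odd N) (hNlb : K₁ ≤ (N : ℝ)) (hNub : (N : ℝ) ≤ K₂)
    (t : ℤ) (ht : N ≡ 8 * t ^ 3 [ZMOD (m : ℤ)])
    (htlb : ε * m ≤ (t : ℝ)) (htub : (t : ℝ) < δ * m) :
    ∃ a b c d e f g : ℕ,
      N = (a : ℤ) ^ 3 + (b : ℤ) ^ 3 + (c : ℤ) ^ 3 + (d : ℤ) ^ 3
        + (e : ℤ) ^ 3 + (f : ℤ) ^ 3 + (g : ℤ) ^ 3 := by
  obtain ⟨r, rfl⟩ := h3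
  have hr : Odd r := by
    rw [← Nat.not_even_iff_odd, even_iff_two_dvd]
    intro h2
    have := hp 2 Nat.prime_two (by rwa [Nat.mul_div_cancel_left r (by norm_num)])
    omega
  have hrpos : 0 < r := by omega
  obtain ⟨q, hq⟩ := ht.symm.dvd
  have hm : (0 : ℝ) < (3 * r : ℕ) := by exact_mod_cast hmpos
  have ht0 : (0 : ℝ) ≤ t := (by positivity : (0 : ℝ) ≤ ε * (3 * r : ℕ)).trans htlb
  have hlt : (t : ℝ) ^ 3 < (δ * (3 * r : ℕ)) ^ 3 := pow_lt_pow_left₀ htub ht0 (by norm_num)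
  have hle : (ε * (3 * r : ℕ)) ^ 3 ≤ (t : ℝ) ^ 3 := pow_le_pow_left₀ (by positivity) htlb 3
  have hqR : (N : ℝ) - 8 * (t : ℝ) ^ 3 = (3 * r : ℕ) * (q : ℝ) := by exact_mod_cast hq
  have hqodd : Odd q := by
    have h8 : Even (8 * t ^ 3) := Even.mul_right (by decide) _
    exact (Int.odd_mul.mp (hq ▸ hodd.sub_even h8)).2
  push_cast at *
  have hlb : (r : ℝ) ^ 2 < 4 * q := by
    refine lt_of_mul_lt_mul_left (a := 3 * (r : ℝ)) ?_ hm.le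
    nlinarith
  have hub : 4 * (q : ℝ) ≤ 2 * r ^ 2 + 2 := by
    refine le_of_mul_le_mul_left (a := 3 * (r : ℝ)) ?_ hm
    nlinarith
  obtain ⟨a, b, c, d, e, f, h⟩ := exists_sum_six_cubes (r := r) (q := q) (by exact_mod_cast hr)
    hqodd (by exact_mod_cast hrpos) (by exact_mod_cast hlb) (by exact_mod_cast hub)
  obtain ⟨u, rfl⟩ := Int.eq_ofNat_of_zero_le (show 0 ≤ t by exact_mod_cast ht0)
  refine ⟨a, b, c, d, e, f, 2 * u, ?_⟩
  push_cast
  linear_combination hq + h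
end

section
/- Let 0 < K₁ < K₂ be real numbers. Let W be a non-empty finite set of positive integers such that every m ∈ W is squarefree, divisible by 3, and every prime divisor of m/3 is ≡ 5 (mod 6); suppose for each m ∈ W there are reals ε_m, δ_m with 0 ≤ ε_m < δ_m ≤ 1, K₁ ≥ (8δ_m³ + 1/36)m³ + 3m/4, and K₂ ≤ (8ε_m³ + 1/18)m³ + m/2. Let M = lcm(W). Let S ⊆ [0,1] be a finite set of rationals a/q in lowest terms with denominators q bounded by (M/(2K₂))^{1/3}. Suppose Bad(W) ∩ [0, M) ⊆ ⋃_{a/q ∈ S} ( (a/q)M − (M/16)^{1/3}/q , (a/q)M + (M/16)^{1/3}/q ). Then every odd integer N with K₁ ≤ N ≤ K₂ is the sum of seven non-negative cubes. -/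
/-- The quotient `Q(x,m) = ⌊x/m⌋`. -/
noncomputable def quo (x : ℝ) (m : ℕ) : ℤ := ⌊x / m⌋

/-- The remainder `R(x,m) = x − Q(x,m)·m ∈ [0,m)`. -/
noncomputable def rem (x : ℝ) (m : ℕ) : ℝ := x - quo x m * m

/-- The bad set `Bad(m,ε,δ) = {x ∈ ℝ : R(x,m) ∉ [ε·m, δ·m)}`. -/
def Bad (m : ℕ) (ε δ : ℝ) : Set ℝ := {x | rem x m ∉ Set.Ico (ε * m) (δ * m)}

/-- `Bad(W) = ⋂_{m ∈ W} Bad(m, ε_m, δ_m)`. -/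
def BadW (W : Finset ℕ) (ε δ : ℕ → ℝ) : Set ℝ := ⋂ m ∈ W, Bad m (ε m) (δ m)

/-- Every integer `b` can be translated by a multiple of `a > 0` into `[-a/2, a/2]`. -/
lemma exists_sq_add_mul_le (a b : ℤ) (ha : 0 < a) : ∃ k : ℤ, 4 * (b + k * a) ^ 2 ≤ a ^ 2 := by
  refine ⟨-((2 * b + a) / (2 * a)), ?_⟩
  have h1 := Int.emod_add_mul_ediv (2 * b + a) (2 * a)
  have h2 := Int.emod_nonneg (2 * b + a) (by lia : (2 * a) ≠ 0)
  have h3 := Int.emod_lt_of_pos (2 * b + a) (by lia : 0 < 2 * a)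
  set q := (2 * b + a) / (2 * a)
  have h4 : (2 * (b + -q * a)) ^ 2 ≤ a ^ 2 := by
    apply sq_le_sq'
    · linarith
    · linarith
  linarith

/-- The values of a positive definite binary quadratic form of determinant `1` are sums of two
squares. -/
theorem binary_form_eq_sq_add_sq (a b c : ℤ) (ha : 0 < a) (hdet : a * c - b ^ 2 = 1) (y z : ℤ) :
    ∃ u v : ℤ, a * y ^ 2 + 2 * b * y * z + c * z ^ 2 = u ^ 2 + v ^ 2 := by
  obtain ⟨k, hk⟩ := exists_sq_add_mul_le a b ha
  obtain ⟨b', hb'⟩ : ∃ b', b' = b + k * a := ⟨_, rfl⟩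
  obtain ⟨c', hc'⟩ : ∃ c', c' = c + 2 * k * b + k ^ 2 * a := ⟨_, rfl⟩
  have hdet' : a * c' - b' ^ 2 = 1 := by rw [hb', hc']; linear_combination hdet
  have hform : a * y ^ 2 + 2 * b * y * z + c * z ^ 2 =
      a * (y - k * z) ^ 2 + 2 * b' * (y - k * z) * z + c' * z ^ 2 := by
    rw [hb', hc']; ring
  rw [← hb'] at hk
  have hc'pos : 0 < c' := by
    by_contra! h
    nlinarith [sq_nonneg b']
  rw [hform]
  by_cases hlt : c' < a
  · obtain ⟨u, v, h⟩ := binary_form_eq_sq_add_sq c' b' a hc'pos (by linarith) z (y - k * z)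
    exact ⟨u, v, by rw [← h]; ring⟩
  · have ha1 : a = 1 := by
      have : a < 2 := by
        by_contra! h
        nlinarith
      lia
    subst ha1
    have hb0 : b' = 0 := by
      have : b' ^ 2 < 1 := by linarith
      exact pow_eq_zero_iff (two_ne_zero) |>.1 (le_antisymm (by lia) (sq_nonneg b'))
    subst hb0
    have hc1 : c' = 1 := by linarith
    subst hc1
    exact ⟨y - k * z, z, by ring⟩
termination_by a.toNat
decreasing_by lia

/-- A reduced positive definite ternary form of determinant `1` has leading coefficient `1`. -/
lemma eq_one_of_minimal {a b f B C D : ℤ} (ha : 0 < a) (hB : 0 < B) (hBdef : B = a * b - f ^ 2)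
    (hBCD : B * C - D ^ 2 = a) (hf : 4 * f ^ 2 ≤ a ^ 2) (hD : 4 * D ^ 2 ≤ B ^ 2) (hab : a ≤ b)
    (hBC : B ≤ C) : a = 1 := by
  have h1 : 3 * B ^ 2 ≤ 4 * a := by nlinarith
  have h2 : 3 * a ^ 2 ≤ 4 * B := by nlinarith
  have : a < 2 := by
    by_contra! h
    have h3 : 3 * a ≤ 2 * B := by nlinarith
    nlinarith
  lia

/-- The values of a positive definite ternary quadratic form of determinant `1` are sums of three
squares. -/
theorem ternary_form_eq_sum_three_sq (a b c d e f : ℤ) (ha : 0 < a) (hB : 0 < a * b - f ^ 2)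
    (hdet : a * (b * c - d ^ 2) - f * (f * c - d * e) + e * (f * d - b * e) = 1) (x y z : ℤ) :
    ∃ u v w : ℤ, a * x ^ 2 + b * y ^ 2 + c * z ^ 2 + 2 * d * y * z + 2 * e * x * z +
      2 * f * x * y = u ^ 2 + v ^ 2 + w ^ 2 := by
  obtain ⟨k, hk⟩ := exists_sq_add_mul_le a f ha
  obtain ⟨f', hf'⟩ : ∃ f', f' = f + k * a := ⟨_, rfl⟩
  obtain ⟨b', hb'⟩ : ∃ b', b' = b + 2 * k * f + k ^ 2 * a := ⟨_, rfl⟩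
  obtain ⟨d', hd'⟩ : ∃ d', d' = d + k * e := ⟨_, rfl⟩
  obtain ⟨x', hx'⟩ : ∃ x', x' = x - k * y := ⟨_, rfl⟩
  rw [← hf'] at hk
  have hBeq : a * b' - f' ^ 2 = a * b - f ^ 2 := by rw [hf', hb']; ring
  have hdet' : a * (b' * c - d' ^ 2) - f' * (f' * c - d' * e) + e * (f' * d' - b' * e) = 1 := by
    rw [hf', hb', hd']; linear_combination hdet
  have hform : a * x ^ 2 + b * y ^ 2 + c * z ^ 2 + 2 * d * y * z + 2 * e * x * z + 2 * f * x * y =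
      a * x' ^ 2 + b' * y ^ 2 + c * z ^ 2 + 2 * d' * y * z + 2 * e * x' * z + 2 * f' * x' * y := by
    rw [hf', hb', hd', hx']; ring
  have hb'pos : 0 < b' :=
    pos_of_mul_pos_right (by linarith [sq_nonneg f'] : 0 < a * b') ha.le
  rw [hform]
  by_cases hba : b' < a
  · obtain ⟨u, v, w, h⟩ := ternary_form_eq_sum_three_sq b' a c e d' f' hb'pos (by linarith)
      (by linear_combination hdet') y x' z
    exact ⟨u, v, w, by rw [← h]; ring⟩
  obtain ⟨l, hl⟩ := exists_sq_add_mul_le (a * b' - f' ^ 2) (a * d' - e * f') (by linarith)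
  obtain ⟨c', hc'⟩ : ∃ c', c' = c + 2 * l * d' + l ^ 2 * b' := ⟨_, rfl⟩
  obtain ⟨e', he'⟩ : ∃ e', e' = e + l * f' := ⟨_, rfl⟩
  obtain ⟨d₂, hd₂⟩ : ∃ d₂, d₂ = d' + l * b' := ⟨_, rfl⟩
  obtain ⟨y', hy'⟩ : ∃ y', y' = y - l * z := ⟨_, rfl⟩
  obtain ⟨B, hBdef⟩ : ∃ B, B = a * b' - f' ^ 2 := ⟨_, rfl⟩
  obtain ⟨C, hCdef⟩ : ∃ C, C = a * c' - e' ^ 2 := ⟨_, rfl⟩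
  obtain ⟨D, hDdef⟩ : ∃ D, D = a * d₂ - e' * f' := ⟨_, rfl⟩
  have hdet₂ : a * (b' * c' - d₂ ^ 2) - f' * (f' * c' - d₂ * e') + e' * (f' * d₂ - b' * e') = 1 := by
    rw [hc', he', hd₂]; linear_combination hdet'
  have hform₂ : a * x' ^ 2 + b' * y ^ 2 + c * z ^ 2 + 2 * d' * y * z + 2 * e * x' * z +
      2 * f' * x' * y = a * x' ^ 2 + b' * y' ^ 2 + c' * z ^ 2 + 2 * d₂ * y' * z +
        2 * e' * x' * z + 2 * f' * x' * y' := by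
    rw [hc', he', hd₂, hy']; ring
  have hBCD : B * C - D ^ 2 = a := by
    rw [hBdef, hCdef, hDdef]; linear_combination a * hdet₂
  have hl' : 4 * D ^ 2 ≤ B ^ 2 := by
    have : D = a * d' - e * f' + l * (a * b' - f' ^ 2) := by rw [hDdef, hd₂, he']; ring
    rwa [this, hBdef]
  have hBpos : 0 < B := by linarith
  have hCpos : 0 < C :=
    pos_of_mul_pos_right (by linarith [sq_nonneg D] : 0 < B * C) hBpos.le
  rw [hform₂]
  by_cases hCB : C < B
  · obtain ⟨u, v, w, h⟩ := ternary_form_eq_sum_three_sq a c' b' d₂ f' e' ha (by linarith)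
      (by linear_combination hdet₂) x' z y'
    exact ⟨u, v, w, by rw [← h]; ring⟩
  · have ha1 : a = 1 := eq_one_of_minimal ha hBpos hBdef hBCD hk hl' (not_lt.1 hba) (not_lt.1 hCB)
    subst ha1
    obtain ⟨u, v, h⟩ := binary_form_eq_sq_add_sq B D C hBpos (by linarith) y' z
    refine ⟨x' + f' * y' + e' * z, u, v, ?_⟩
    rw [add_assoc ((x' + f' * y' + e' * z) ^ 2), ← h, hBdef, hCdef, hDdef]
    ring
termination_by (a.toNat, (a * b - f ^ 2).toNat)
decreasing_by
  · apply Prod.Lex.left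
    clear * - ha hba
    lia
  · apply Prod.Lex.right
    rw [← hBeq, ← hBdef, ← hCdef]
    clear * - hCB hBpos
    lia

/-- A natural number congruent to `3` modulo `8` is a sum of three squares of integers. -/
theorem eq_sum_three_sq_of_mod_eight (n : ℕ) (hn : n % 8 = 3) :
    ∃ u v w : ℤ, (n : ℤ) = u ^ 2 + v ^ 2 + w ^ 2 := by
  obtain ⟨h, rfl⟩ : ∃ h, n = 2 * h + 1 := ⟨n / 2, by lia⟩
  have hcop : h.Coprime (4 * (2 * h + 1)) := by
    refine Nat.Coprime.mul_right ?_ ?_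
    · have : Nat.Coprime h 2 := Nat.coprime_two_right.2 (Nat.odd_iff.2 (by lia))
      exact this.mul_right this
    · simp
  obtain ⟨p, -, hp, hpmod⟩ := Nat.forall_exists_prime_gt_and_modEq 0 (by lia) hcop
  obtain ⟨j, hj⟩ : ∃ j, p = 4 * (2 * h + 1) * j + h := by
    refine ⟨p / (4 * (2 * h + 1)), ?_⟩
    have h1 := Nat.div_add_mod p (4 * (2 * h + 1))
    have h2 : p % (4 * (2 * h + 1)) = h := by rw [hpmod, Nat.mod_eq_of_lt (by lia)]
    lia
  have h4 : h % 4 = 1 := by lia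
  have hp4 : p % 4 = 1 := by rw [hj, mul_assoc]; lia
  have hdn : (8 * j + 1) * (2 * h + 1) = 2 * p + 1 := by rw [hj]; ring
  have : Fact p.Prime := ⟨hp⟩
  have hdodd : Odd (8 * j + 1) := ⟨4 * j, by ring⟩
  have hJ2 : jacobiSym (-2) (8 * j + 1) = 1 := by
    rw [jacobiSym.at_neg_two hdodd, ZMod.χ₈'_nat_eq_if_mod_eight]
    have h1 : (8 * j + 1) % 2 = 1 := by lia
    have h2 : (8 * j + 1) % 8 = 1 := by lia
    simp [h1, h2]
  have hJp : jacobiSym p (8 * j + 1) = 1 := by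
    have h1 : jacobiSym (-2 * p) (8 * j + 1) = jacobiSym 1 (8 * j + 1) := by
      apply jacobiSym.mod_left'
      apply Int.ModEq.symm
      rw [Int.modEq_iff_dvd]
      refine ⟨-(2 * h + 1), ?_⟩
      zify at hdn
      push_cast
      linear_combination hdn
    rwa [jacobiSym.mul_left, hJ2, jacobiSym.one_left, one_mul] at h1
  have hJ : jacobiSym (-((8 * j + 1 : ℕ) : ℤ)) p = 1 := by
    rw [jacobiSym.neg _ (Nat.odd_iff.2 (by lia)), ZMod.χ₄_nat_one_mod_four hp4,
      jacobiSym.quadratic_reciprocity_one_mod_four' hdodd hp4, hJp, one_mul]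
  obtain ⟨s, hs⟩ := ZMod.isSquare_of_jacobiSym_eq_one hJ
  obtain ⟨s, rfl⟩ := ZMod.intCast_surjective s
  have hs1 : (p : ℤ) ∣ s ^ 2 + (8 * j + 1) := by
    rw [← ZMod.intCast_zmod_eq_zero_iff_dvd]
    push_cast at hs ⊢
    rw [sq, ← hs]
    ring
  obtain ⟨t, ht, htodd⟩ : ∃ t : ℤ, (p : ℤ) ∣ t ^ 2 + (8 * j + 1) ∧ Odd t := by
    rcases Int.even_or_odd s with he | ho
    · refine ⟨s + p, ?_, he.add_odd ?_⟩
      · have : (s + p) ^ 2 + (8 * j + 1) = (s ^ 2 + (8 * j + 1)) + p * (2 * s + p) := by ring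
        rw [this]
        exact dvd_add hs1 (dvd_mul_right _ _)
      · exact_mod_cast Nat.odd_iff.2 (by lia)
    · exact ⟨s, hs1, ho⟩
  have h2p : (2 * p : ℤ) ∣ t ^ 2 + (8 * j + 1) := by
    refine IsCoprime.mul_dvd ?_ ?_ ht
    · have : Nat.Coprime 2 p := Nat.coprime_two_left.2 (Nat.odd_iff.2 (by lia))
      exact_mod_cast Nat.isCoprime_iff_coprime.2 this
    · exact even_iff_two_dvd.1 (htodd.pow.add_odd ⟨4 * j, by ring⟩)
  obtain ⟨a, ha⟩ := h2p
  have hppos : (0 : ℤ) < p := by exact_mod_cast hp.pos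
  have hapos : 0 < a := by
    by_contra! h
    nlinarith [sq_nonneg t]
  zify at hdn
  obtain ⟨u, v, w, huvw⟩ := ternary_form_eq_sum_three_sq a (2 * p) (2 * h + 1) 0 1 t hapos
    (by nlinarith) (by linear_combination hdn - (2 * h + 1) * ha) 0 0 1
  refine ⟨u, v, w, ?_⟩
  rw [← huvw]
  push_cast
  ring

/-- A pair of complementary cubes `((k + u) / 2) ^ 3 + ((k - u) / 2) ^ 3`. -/
lemma exists_four_mul_add_cubes {k u : ℤ} (hk : 0 < k) (hko : Odd k) (huo : Odd u)
    (hu : u ^ 2 ≤ k ^ 2) : ∃ a b : ℕ, 4 * ((a : ℤ) ^ 3 + (b : ℤ) ^ 3) = k ^ 3 + 3 * k * u ^ 2 := by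
  obtain ⟨h1, h2⟩ := abs_le.1 (abs_le_of_sq_le_sq hu hk.le)
  obtain ⟨r, hr⟩ := hko.add_odd huo
  obtain ⟨s, hs⟩ := hko.sub_odd huo
  lift r to ℕ using by lia
  lift s to ℕ using by lia
  refine ⟨r, s, ?_⟩
  obtain rfl : k = r + s := by lia
  obtain rfl : u = r - s := by lia
  ring

/-- If a sum of three squares is `3` modulo `8`, the three squares are odd. -/
lemma odd_of_sum_three_sq {u v w : ℤ} (h : (u ^ 2 + v ^ 2 + w ^ 2) % 8 = 3) :
    Odd u ∧ Odd v ∧ Odd w := by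
  have key : ∀ x : ℤ, Even x ∧ x ^ 2 % 4 = 0 ∨ Odd x ∧ x ^ 2 % 4 = 1 := by
    intro x
    rcases Int.even_or_odd x with he | ho
    · refine Or.inl ⟨he, ?_⟩
      obtain ⟨y, rfl⟩ := he
      ring_nf
      lia
    · refine Or.inr ⟨ho, ?_⟩
      obtain ⟨y, rfl⟩ := ho
      ring_nf
      lia
  rcases key u with ⟨hu, hu'⟩ | ⟨hu, hu'⟩ <;> rcases key v with ⟨hv, hv'⟩ | ⟨hv, hv'⟩ <;>
    rcases key w with ⟨hw, hw'⟩ | ⟨hw, hw'⟩ <;>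
    first
    | exact ⟨hu, hv, hw⟩
    | (exfalso; lia)

/-- The square of an odd integer is at least `1`. -/
lemma one_le_sq_of_odd {u : ℤ} (hu : Odd u) : 1 ≤ u ^ 2 := by
  have : u ≠ 0 := by rintro rfl; simp at hu
  have := sq_pos_of_ne_zero this
  lia

/-- An odd integer `N ≡ 8 t ^ 3` modulo `3 k` is a sum of seven non-negative cubes as soon as
`N - 8 t ^ 3` lies in a suitable range. -/
theorem exists_seven_cubes_of_dvd {k t N : ℤ} (hk : 0 < k) (hko : Odd k) (hN : Odd N) (ht : 0 ≤ t)
    (hdvd : 3 * k ∣ N - 8 * t ^ 3) (hlb : 3 * k ^ 3 + 9 * k ≤ 4 * (N - 8 * t ^ 3))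
    (hub : 4 * (N - 8 * t ^ 3) ≤ 6 * k ^ 3 + 6 * k) :
    ∃ a b c d e f g : ℕ,
      N = (a : ℤ) ^ 3 + (b : ℤ) ^ 3 + (c : ℤ) ^ 3 + (d : ℤ) ^ 3
        + (e : ℤ) ^ 3 + (f : ℤ) ^ 3 + (g : ℤ) ^ 3 := by
  obtain ⟨s, hs⟩ := hdvd
  have hso : Odd s := by
    have : Odd (N - 8 * t ^ 3) := hN.sub_even ((by decide : Even (8 : ℤ)).mul_right _)
    rw [hs] at this
    exact (Int.odd_mul.1 this).2
  have h3 : 3 ≤ 4 * s - k ^ 2 := by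
    have : (3 * k) * (k ^ 2 + 3) ≤ (3 * k) * (4 * s) := by linarith
    linarith [le_of_mul_le_mul_left this (by lia)]
  have h4 : 4 * s - k ^ 2 ≤ k ^ 2 + 2 := by
    have : (3 * k) * (4 * s) ≤ (3 * k) * (2 * k ^ 2 + 2) := by linarith
    linarith [le_of_mul_le_mul_left this (by lia)]
  have hmod : (4 * s - k ^ 2) % 8 = 3 := by
    obtain ⟨i, hi⟩ := hko
    obtain ⟨l, hl⟩ := hso
    obtain ⟨r, hr⟩ := Int.even_mul_succ_self i
    have : k ^ 2 = 4 * (r + r) + 1 := by rw [← hr, hi]; ring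
    lia
  obtain ⟨n, hn⟩ := Int.eq_ofNat_of_zero_le (by lia : 0 ≤ 4 * s - k ^ 2)
  obtain ⟨u, v, w, huvw⟩ := eq_sum_three_sq_of_mod_eight n (by lia)
  obtain ⟨hu, hv, hw⟩ := odd_of_sum_three_sq (by rw [← huvw, ← hn]; exact hmod)
  have hu1 := one_le_sq_of_odd hu
  have hv1 := one_le_sq_of_odd hv
  have hw1 := one_le_sq_of_odd hw
  obtain ⟨a, b, hab⟩ := exists_four_mul_add_cubes hk hko hu (by lia)
  obtain ⟨c, d, hcd⟩ := exists_four_mul_add_cubes hk hko hv (by lia)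
  obtain ⟨e, f, hef⟩ := exists_four_mul_add_cubes hk hko hw (by lia)
  lift t to ℕ using ht
  refine ⟨a, b, c, d, e, f, 2 * t, ?_⟩
  push_cast
  rw [← hn] at huvw
  have : 4 * N = 4 * ((a : ℤ) ^ 3 + (b : ℤ) ^ 3 + (c : ℤ) ^ 3 + (d : ℤ) ^ 3
        + (e : ℤ) ^ 3 + (f : ℤ) ^ 3 + (2 * (t : ℤ)) ^ 3) := by
    linear_combination 4 * hs - hab - hcd - hef + 3 * k * huvw
  lia

/-- Fermat's little theorem for a squarefree modulus. -/
lemma squarefree_dvd_pow_sub_self {m L : ℕ} (hm : Squarefree m)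
    (hL : ∀ p ∈ m.primeFactors, p - 1 ∣ L) (x : ℤ) : (m : ℤ) ∣ x ^ (1 + L) - x := by
  rw [Int.natCast_dvd, ← Nat.prod_primeFactors_of_squarefree hm]
  refine Finset.prod_primes_dvd _ (fun p hp => (Nat.prime_of_mem_primeFactors hp).prime) ?_
  intro p hp
  have : Fact p.Prime := ⟨Nat.prime_of_mem_primeFactors hp⟩
  obtain ⟨j, hj⟩ := hL p hp
  rw [← Int.natCast_dvd, ← ZMod.intCast_zmod_eq_zero_iff_dvd, hj]
  push_cast
  by_cases hx : (x : ZMod p) = 0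
  · simp [hx]
  · rw [pow_add, pow_mul, ZMod.pow_card_sub_one_eq_one hx]
    simp

/-- For squarefree moduli without prime factors congruent to `1` modulo `3`, every integer is a
cube modulo their least common multiple. -/
lemma exists_lcm_dvd_sub_cube (W : Finset ℕ) (hsq : ∀ m ∈ W, Squarefree m)
    (hW : ∀ m ∈ W, ∀ p ∈ m.primeFactors, p % 3 ≠ 1) (x : ℤ) :
    ∃ y : ℤ, ((W.lcm id : ℕ) : ℤ) ∣ x - y ^ 3 := by
  set L := ∏ m ∈ W, ∏ p ∈ m.primeFactors, (p - 1) with hLdef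
  have hL3 : ¬ 3 ∣ L := by
    rw [hLdef, Nat.prime_three.prime.dvd_finsetProd_iff]
    rintro ⟨m, hm, h⟩
    rw [Nat.prime_three.prime.dvd_finsetProd_iff] at h
    obtain ⟨p, hp, h⟩ := h
    have := hW m hm p hp
    have := (Nat.prime_of_mem_primeFactors hp).two_le
    lia
  obtain ⟨e, he⟩ : 3 ∣ 1 + 2 * L ^ 2 := by
    have h1 : L % 3 = 1 ∨ L % 3 = 2 := by lia
    apply Nat.dvd_of_mod_eq_zero
    rcases h1 with h1 | h1 <;> simp [Nat.add_mod, Nat.mul_mod, Nat.pow_mod, h1]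
  refine ⟨x ^ e, ?_⟩
  rw [← pow_mul, mul_comm e, ← he, Int.natCast_dvd]
  refine Finset.lcm_dvd fun m hm => ?_
  rw [id, ← Int.natCast_dvd, dvd_sub_comm]
  refine squarefree_dvd_pow_sub_self (hsq m hm) (fun p hp => ?_) x
  refine Dvd.dvd.mul_left (dvd_pow ?_ two_ne_zero) _
  exact (Finset.dvd_prod_of_mem (fun p => p - 1) hp).trans
    (Finset.dvd_prod_of_mem (fun m => ∏ p ∈ Nat.primeFactors m, (p - 1)) hm)

/-- The least common multiple of a finite set of odd numbers is odd. -/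
lemma odd_finset_lcm (W : Finset ℕ) (hW : ∀ m ∈ W, Odd m) : Odd (W.lcm id) := by
  refine Odd.of_dvd_nat (Finset.prod_induction id Odd (fun _ _ => Odd.mul) odd_one hW) ?_
  exact Finset.lcm_dvd fun m hm => Finset.dvd_prod_of_mem id hm

/-- For odd squarefree moduli without prime factors congruent to `1` modulo `3`, every integer is
`8` times a cube modulo their least common multiple `M`, with cube root in `[0, M)`. -/
lemma exists_lcm_dvd_sub_eight_mul_cube (W : Finset ℕ) (hsq : ∀ m ∈ W, Squarefree m)
    (hodd : ∀ m ∈ W, Odd m) (hW : ∀ m ∈ W, ∀ p ∈ m.primeFactors, p % 3 ≠ 1) (x : ℤ) :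
    ∃ t : ℤ, 0 ≤ t ∧ t < (W.lcm id : ℕ) ∧ ((W.lcm id : ℕ) : ℤ) ∣ x - 8 * t ^ 3 := by
  obtain ⟨y, hy⟩ := exists_lcm_dvd_sub_cube W hsq hW x
  have hM := odd_finset_lcm W hodd
  set M := W.lcm id
  have hMpos : (0 : ℤ) < M := by exact_mod_cast hM.pos
  obtain ⟨h, hh⟩ := hM
  have hh' : (M : ℤ) = 2 * h + 1 := by exact_mod_cast hh
  refine ⟨(y * (h + 1)) % M, Int.emod_nonneg _ hMpos.ne', Int.emod_lt_of_pos _ hMpos, ?_⟩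
  rw [← Int.modEq_iff_dvd] at hy ⊢
  refine Int.ModEq.trans ?_ hy
  calc 8 * ((y * (h + 1)) % M) ^ 3 ≡ 8 * (y * (h + 1)) ^ 3 [ZMOD M] :=
        ((Int.mod_modEq _ _).pow 3).mul_left 8
    _ = (y * (M + 1)) ^ 3 := by rw [hh']; ring
    _ ≡ (y * (0 + 1)) ^ 3 [ZMOD M] := by
        refine ((Int.ModEq.add_right 1 ?_).mul_left y).pow 3
        simp [Int.ModEq]
    _ = y ^ 3 := by ring

/-- The remainder of an integer is its usual remainder modulo `m`. -/
lemma rem_intCast (t : ℤ) {m : ℕ} (hm : 0 < m) : rem t m = ((t % m : ℤ) : ℝ) := by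
  have : quo t m = t / m := by
    rw [quo, Int.floor_eq_iff]
    have hm' : (0 : ℝ) < m := by exact_mod_cast hm
    have hmz : (0 : ℤ) < m := by exact_mod_cast hm
    constructor
    · rw [le_div_iff₀ hm']
      exact_mod_cast Int.ediv_mul_le t hmz.ne'
    · rw [div_lt_iff₀ hm']
      exact_mod_cast Int.lt_ediv_add_one_mul_self t hmz
  rw [rem, this, Int.emod_def]
  push_cast
  ring

/-- An integer whose product with a positive cube is `8` times a cube is a cube. -/
lemma exists_eq_cube_of_mul_cube {N q s : ℤ} (hN : 0 ≤ N) (hq : 0 < q)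
    (h : q ^ 3 * N = 8 * s ^ 3) : ∃ a : ℕ, N = (a : ℤ) ^ 3 := by
  have hdvd : q ∣ 2 * s := by
    rw [← Int.pow_dvd_pow_iff (three_ne_zero)]
    exact ⟨N, by rw [h]; ring⟩
  obtain ⟨a, ha⟩ := hdvd
  have hNa : N = a ^ 3 := by
    have : q ^ 3 * N = q ^ 3 * a ^ 3 := by
      rw [h, ← mul_pow, ← ha]; ring
    exact mul_left_cancel₀ (by positivity) this
  have ha0 : 0 ≤ a := by
    rw [hNa] at hN
    exact (Odd.pow_nonneg_iff (by decide)).1 hN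
  lift a to ℕ using ha0
  exact ⟨a, hNa⟩

/-- If `t` is close to `r * M` for a rational `r` of small denominator, then `8 t ^ 3 ≡ N` modulo
`M` forces `N` to be a cube. -/
lemma exists_eq_cube_of_close {M N t : ℤ} {K : ℝ} {r : ℚ} (hM : 0 < M) (hN : 0 ≤ N) (hK : 0 < K)
    (hNK : (N : ℝ) ≤ K) (hdvd : M ∣ N - 8 * t ^ 3)
    (hr : (r.den : ℝ) ≤ ((M : ℝ) / (2 * K)) ^ ((1 : ℝ) / 3))
    (hclose : |(t : ℝ) - r * M| < ((M : ℝ) / 16) ^ ((1 : ℝ) / 3) / r.den) :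
    ∃ a : ℕ, N = (a : ℤ) ^ 3 := by
  have hMR : (0 : ℝ) < M := by exact_mod_cast hM
  have hrpow : ∀ y : ℝ, 0 < y → (y ^ ((1 : ℝ) / 3)) ^ 3 = y := by
    intro y hy
    rw [← Real.rpow_natCast, ← Real.rpow_mul hy.le]
    norm_num
  have hq : (0 : ℝ) < r.den := by exact_mod_cast r.pos
  have hqZ : (0 : ℤ) < r.den := by exact_mod_cast r.pos
  set s : ℤ := r.den * t - r.num * M with hs
  have hsR : |(s : ℝ)| < ((M : ℝ) / 16) ^ ((1 : ℝ) / 3) := by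
    rw [lt_div_iff₀ hq] at hclose
    have hrd : (r : ℝ) * r.den = r.num := by exact_mod_cast r.mul_den_eq_num
    have hsr : (s : ℝ) = (t - r * M) * r.den := by
      rw [hs]
      push_cast
      linear_combination (M : ℝ) * hrd
    rwa [hsr, abs_mul, abs_of_pos hq]
  have hs3 : |8 * (s : ℝ) ^ 3| < (M : ℝ) / 2 := by
    have := pow_lt_pow_left₀ hsR (abs_nonneg _) three_ne_zero
    rw [hrpow _ (by positivity)] at this
    rw [abs_mul, abs_pow, abs_of_pos (by norm_num : (0 : ℝ) < 8)]
    linarith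
  have hqN : (r.den : ℝ) ^ 3 * N ≤ M / 2 := by
    have h1 := pow_le_pow_left₀ hq.le hr 3
    rw [hrpow _ (by positivity), le_div_iff₀ (by positivity)] at h1
    have h2 : (r.den : ℝ) ^ 3 * N ≤ (r.den : ℝ) ^ 3 * K := by gcongr
    linarith
  have hqN0 : (0 : ℝ) ≤ (r.den : ℝ) ^ 3 * N := by
    have : (0 : ℝ) ≤ N := by exact_mod_cast hN
    positivity
  have hlt : |(r.den : ℤ) ^ 3 * N - 8 * s ^ 3| < M := by
    have : |(r.den : ℝ) ^ 3 * N - 8 * (s : ℝ) ^ 3| < (M : ℝ) := by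
      rw [abs_lt] at hs3 ⊢
      constructor <;> linarith [hs3.1, hs3.2]
    exact_mod_cast this
  have hdvd' : M ∣ (r.den : ℤ) ^ 3 * N - 8 * s ^ 3 := by
    have : (r.den : ℤ) ^ 3 * N - 8 * s ^ 3 = (r.den : ℤ) ^ 3 * (N - 8 * t ^ 3) +
        M * (8 * r.num * (3 * (r.den * t) ^ 2 - 3 * (r.den * t) * (r.num * M) +
          (r.num * M) ^ 2)) := by
      rw [hs]; ring
    rw [this]
    exact dvd_add (hdvd.mul_left _) (dvd_mul_right _ _)
  exact exists_eq_cube_of_mul_cube hN hqZ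
    (sub_eq_zero.1 (Int.eq_zero_of_abs_lt_dvd hdvd' hlt))

/-- The Main Criterion: if the bad set `Bad(W) ∩ [0, M)` is covered by small
neighbourhoods of the rationals `(a/q)·M` with `a/q ∈ S`, then every odd
integer `K₁ ≤ N ≤ K₂` is the sum of seven non-negative cubes. -/
theorem main_criterion_sum_seven_cubes
    (K₁ K₂ : ℝ) (hK₁pos : 0 < K₁) (hK₁K₂ : K₁ < K₂)
    (W : Finset ℕ) (hW : W.Nonempty)
    (hWcond : ∀ m ∈ W, 0 < m ∧ Squarefree m ∧ 3 ∣ m ∧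
      ∀ p : ℕ, p.Prime → p ∣ m / 3 → p % 6 = 5)
    (ε δ : ℕ → ℝ)
    (hεδ : ∀ m ∈ W, 0 ≤ ε m ∧ ε m < δ m ∧ δ m ≤ 1 ∧
      (8 * δ m ^ 3 + 1 / 36) * (m : ℝ) ^ 3 + 3 * m / 4 ≤ K₁ ∧
      K₂ ≤ (8 * ε m ^ 3 + 1 / 18) * (m : ℝ) ^ 3 + m / 2)
    (S : Finset ℚ)
    (hS : ∀ r ∈ S, 0 ≤ r ∧ r ≤ 1 ∧
      (r.den : ℝ) ≤ (((W.lcm id : ℕ) : ℝ) / (2 * K₂)) ^ ((1 : ℝ) / 3))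
    (hdecomp : BadW W ε δ ∩ Set.Ico (0 : ℝ) ((W.lcm id : ℕ) : ℝ) ⊆
      ⋃ r ∈ S, Set.Ioo
        ((r : ℝ) * ((W.lcm id : ℕ) : ℝ) - (((W.lcm id : ℕ) : ℝ) / 16) ^ ((1 : ℝ) / 3) / (r.den : ℝ))
        ((r : ℝ) * ((W.lcm id : ℕ) : ℝ) + (((W.lcm id : ℕ) : ℝ) / 16) ^ ((1 : ℝ) / 3) / (r.den : ℝ)))
    (N : ℤ) (hodd : Odd N) (hNlb : K₁ ≤ (N : ℝ)) (hNub : (N : ℝ) ≤ K₂) :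
    ∃ a b c d e f g : ℕ,
      N = (a : ℤ) ^ 3 + (b : ℤ) ^ 3 + (c : ℤ) ^ 3 + (d : ℤ) ^ 3
        + (e : ℤ) ^ 3 + (f : ℤ) ^ 3 + (g : ℤ) ^ 3 := by
  have hNpos : 0 < N := by exact_mod_cast hK₁pos.trans_le hNlb
  have hprime : ∀ m ∈ W, ∀ p : ℕ, p.Prime → p ∣ m → p = 3 ∨ p % 6 = 5 := by
    intro m hm p hp hpm
    obtain ⟨-, -, h3, h5⟩ := hWcond m hm
    rw [← Nat.mul_div_cancel' h3, hp.dvd_mul] at hpm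
    rcases hpm with h | h
    · exact Or.inl ((Nat.prime_dvd_prime_iff_eq hp Nat.prime_three).1 h)
    · exact Or.inr (h5 p hp h)
  have hWodd : ∀ m ∈ W, Odd m := by
    intro m hm
    rw [← Nat.not_even_iff_odd, even_iff_two_dvd]
    intro h
    have := hprime m hm 2 Nat.prime_two h
    lia
  have hW3 : ∀ m ∈ W, ∀ p ∈ m.primeFactors, p % 3 ≠ 1 := by
    intro m hm p hp
    have := hprime m hm p (Nat.prime_of_mem_primeFactors hp) (Nat.dvd_of_mem_primeFactors hp)
    lia
  obtain ⟨T, hT0, hTM, hdvd⟩ := exists_lcm_dvd_sub_eight_mul_cube W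
    (fun m hm => (hWcond m hm).2.1) hWodd hW3 N
  by_cases hbad : (T : ℝ) ∈ BadW W ε δ
  · have hmem := hdecomp ⟨hbad, by exact_mod_cast hT0, by exact_mod_cast hTM⟩
    simp only [Set.mem_iUnion, Set.mem_Ioo] at hmem
    obtain ⟨r, hr, h1, h2⟩ := hmem
    obtain ⟨a, ha⟩ := exists_eq_cube_of_close (M := (W.lcm id : ℕ)) (r := r) (by lia) hNpos.le
      (hK₁pos.trans hK₁K₂) hNub hdvd (by exact_mod_cast (hS r hr).2.2) (by
        rw [abs_lt]
        push_cast
        constructor <;> linarith)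
    exact ⟨a, 0, 0, 0, 0, 0, 0, by simp [ha]⟩
  · simp only [BadW, Bad, Set.mem_iInter, Set.mem_ofPred_eq, not_forall, not_not] at hbad
    obtain ⟨m, hm, hmem⟩ := hbad
    obtain ⟨hmpos, -, ⟨k, rfl⟩, -⟩ := hWcond m hm
    obtain ⟨hε, -, -, hlb, hub⟩ := hεδ _ hm
    rw [rem_intCast T hmpos] at hmem
    have ht0 : 0 ≤ T % ((3 * k : ℕ) : ℤ) := Int.emod_nonneg _ (by lia)
    have hdvdm : ((3 * k : ℕ) : ℤ) ∣ N - 8 * (T % ((3 * k : ℕ) : ℤ)) ^ 3 := by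
      have h1 : ((3 * k : ℕ) : ℤ) ∣ N - 8 * T ^ 3 :=
        (Int.natCast_dvd_natCast.2 (Finset.dvd_lcm (f := id) hm)).trans hdvd
      rw [← Int.modEq_iff_dvd] at h1 ⊢
      exact (((Int.mod_modEq _ _).pow 3).mul_left 8).trans h1
    set t := T % ((3 * k : ℕ) : ℤ)
    have htR : (0 : ℝ) ≤ t := by exact_mod_cast ht0
    have hlt := pow_le_pow_left₀ htR hmem.2.le 3
    have hle := pow_le_pow_left₀ (by positivity) hmem.1 3
    push_cast at hlb hub hlt hle hdvdm
    refine exists_seven_cubes_of_dvd (k := k) (t := t) (by lia) ?_ hodd ht0 hdvdm ?_ ?_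
    · exact_mod_cast (Nat.odd_mul.1 (hWodd _ hm)).2
    · have : (3 * k ^ 3 + 9 * k : ℝ) ≤ 4 * (N - 8 * t ^ 3) := by
        rw [mul_pow] at hlt
        linarith
      exact_mod_cast this
    · have : (4 * (N - 8 * t ^ 3) : ℝ) ≤ 6 * k ^ 3 + 6 * k := by
        rw [mul_pow] at hle
        linarith
      exact_mod_cast this
end

section
/- Let L > 0 be real, let W be a non-empty finite set of positive integers all lying in [(263/100)L, (292/100)L], and let M = lcm(W); take ε_m = 0 and δ_m = 1/10 for all m ∈ W. Let a/q ∈ [0,1] be a rational in lowest terms, let d = d(W, a/q) be the defect, and suppose d < (q−10)/10. Let μ = (38398/725)·(1/20 − (d+1)/(2q)). Then μ > 0 and the open interval ( (a/q)M − μL , (a/q)M + μL ) has empty intersection with Bad(W). -/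
/-- The image `Φ_{a/q}(W) = {a·(M/m) mod q : m ∈ W} ⊆ ℤ/qℤ`, where `M = lcm(W)`. -/
def phiImage (W : Finset ℕ) (a q : ℕ) : Set (ZMod q) :=
  {r | ∃ m ∈ W, r = ((a * (W.lcm id / m) : ℕ) : ZMod q)}

/-- The defect `d(W, a/q)`: the length of the longest run of consecutive residue
classes `s+1, s+2, …, s+d` in `ℤ/qℤ` all lying outside the image `Φ_{a/q}(W)`. -/
noncomputable def defect (W : Finset ℕ) (a q : ℕ) : ℕ :=
  sSup {d : ℕ | ∃ s : ZMod q, ∀ j : ℕ, 1 ≤ j → j ≤ d → s + (j : ZMod q) ∉ phiImage W a q}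

/-- Every run of `defect W a q + 1` consecutive residue classes meets the image of `W`. -/
lemma exists_mem_phiImage_of_defect {W : Finset ℕ} (hW : W.Nonempty) {a q : ℕ} (hq : 0 < q)
    (s : ZMod q) :
    ∃ j : ℕ, 1 ≤ j ∧ j ≤ defect W a q + 1 ∧ s + (j : ZMod q) ∈ phiImage W a q := by
  by_contra! h
  have hbdd : BddAbove {d : ℕ | ∃ s : ZMod q, ∀ j : ℕ, 1 ≤ j → j ≤ d →
      s + (j : ZMod q) ∉ phiImage W a q} := by
    refine ⟨q, ?_⟩
    rintro d ⟨s, hs⟩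
    by_contra! hdq
    obtain ⟨m, hm⟩ := hW
    have : NeZero q := ⟨hq.ne'⟩
    set r : ZMod q := ((a * (W.lcm id / m) : ℕ) : ZMod q) with hr
    refine hs ((r - s - 1).val + 1) (by omega) ?_ ⟨m, hm, ?_⟩
    · have := ZMod.val_lt (r - s - 1)
      omega
    · rw [← hr]
      push_cast
      rw [ZMod.natCast_zmod_val]
      ring
  have := le_csSup hbdd ⟨s, h⟩
  change defect W a q + 1 ≤ defect W a q at this
  omega

/-- If `x = (k + y) m` with `k` an integer and `0 ≤ y < δ ≤ 1`, then `x` is not in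
`Bad(m, 0, δ)`. -/
lemma notMem_Bad_of_eq {x y δ : ℝ} {m : ℕ} (hm : 0 < m) (k : ℤ) (hx : x = (k + y) * m)
    (hy : 0 ≤ y) (hyδ : y < δ) (hδ : δ ≤ 1) : x ∉ Bad m 0 δ := by
  have hm' : (0 : ℝ) < m := by exact_mod_cast hm
  have hquo : quo x m = k := by
    rw [quo, Int.floor_eq_iff, hx, mul_div_cancel_right₀ _ hm'.ne']
    constructor <;> linarith
  have hrem : rem x m = y * m := by
    rw [rem, hquo, hx]
    ring
  simp only [Bad, Set.mem_ofPred_eq, not_not, hrem, Set.mem_Ico, zero_mul]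
  exact ⟨by positivity, by gcongr⟩

/-- If `m ∈ [αL, βL]`, then `t / m` differs from `(t / L) (α⁻¹ + β⁻¹) / 2` by at most
`(|t| / L) (α⁻¹ - β⁻¹) / 2`. -/
lemma abs_div_sub_midpoint_le {L m α β : ℝ} (t : ℝ) (hL : 0 < L) (hα : 0 < α)
    (h₁ : α * L ≤ m) (h₂ : m ≤ β * L) :
    |t / m - t / L * ((α⁻¹ + β⁻¹) / 2)| ≤ |t| / L * ((α⁻¹ - β⁻¹) / 2) := by
  have hm : 0 < m := (by positivity : 0 < α * L).trans_le h₁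
  have hβ : 0 < β := pos_of_mul_pos_left (hm.trans_le h₂) hL.le
  have hlow : β⁻¹ ≤ L / m := by
    rw [le_div_iff₀ hm, inv_mul_le_iff₀ hβ]
    exact h₂
  have hupp : L / m ≤ α⁻¹ := by
    rw [div_le_iff₀ hm, le_inv_mul_iff₀ hα]
    exact h₁
  have hfac : t / m - t / L * ((α⁻¹ + β⁻¹) / 2) = t / L * (L / m - (α⁻¹ + β⁻¹) / 2) := by
    field_simp
  rw [hfac, abs_mul, abs_div, abs_of_pos hL]
  gcongr
  rw [abs_le]
  constructor <;> linarith


/-- Gaps: if the defect `d = d(W, a/q)` satisfies `d < (q−10)/10` then, with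
`μ = (38398/725)(1/20 − (d+1)/(2q))`, we have `μ > 0` and the interval
`((a/q)M − μL, (a/q)M + μL)` contains no point of `Bad(W)`. -/
theorem gaps (L : ℝ) (hL : 0 < L) (W : Finset ℕ) (hW : W.Nonempty)
    (hWint : ∀ m ∈ W, (263 / 100 : ℝ) * L ≤ (m : ℝ) ∧ (m : ℝ) ≤ (292 / 100 : ℝ) * L)
    (a q : ℕ) (hq : 0 < q) (haq : a ≤ q) (hcop : Nat.Coprime a q)
    (hd : (defect W a q : ℝ) < ((q : ℝ) - 10) / 10) :
    0 < (38398 / 725 : ℝ) * (1 / 20 - ((defect W a q : ℝ) + 1) / (2 * q)) ∧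
    Set.Ioo
        ((a : ℝ) / q * ((W.lcm id : ℕ) : ℝ)
          - (38398 / 725 : ℝ) * (1 / 20 - ((defect W a q : ℝ) + 1) / (2 * q)) * L)
        ((a : ℝ) / q * ((W.lcm id : ℕ) : ℝ)
          + (38398 / 725 : ℝ) * (1 / 20 - ((defect W a q : ℝ) + 1) / (2 * q)) * L)
      ∩ BadW W (fun _ => 0) (fun _ => 1 / 10) = ∅ := by
  have hq' : (0 : ℝ) < q := by exact_mod_cast hq
  set d := defect W a q with hd_def
  set ρ : ℝ := 1 / 20 - ((d : ℝ) + 1) / (2 * q) with hρ_def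
  have hρ : 0 < ρ := by
    rw [hρ_def, sub_pos, div_lt_iff₀ (by positivity)]
    linarith
  refine ⟨by positivity, Set.eq_empty_iff_forall_notMem.mpr ?_⟩
  rintro x ⟨⟨hx₁, hx₂⟩, hxW⟩
  set t : ℝ := x - (a : ℝ) / q * ((W.lcm id : ℕ) : ℝ) with ht_def
  set c : ℝ := t / L * (((263 / 100 : ℝ)⁻¹ + (292 / 100 : ℝ)⁻¹) / 2) with hc_def
  set h : ℝ := |t| / L * (((263 / 100 : ℝ)⁻¹ - (292 / 100 : ℝ)⁻¹) / 2) with hh_def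
  have hh : h < ρ := by
    have htL : |t| / L < 38398 / 725 * ρ := by
      rw [div_lt_iff₀ hL, abs_lt]
      constructor <;> linarith
    rw [hh_def]
    norm_num
    linarith
  set s : ℤ := ⌈(q : ℝ) * (h - c)⌉ - 1 with hs_def
  obtain ⟨j, hj₁, hj₂, m, hm, hjm⟩ := exists_mem_phiImage_of_defect (a := a) hW hq (s : ZMod q)
  obtain ⟨hm₁, hm₂⟩ := hWint m hm
  have hm_real : (0 : ℝ) < m := lt_of_lt_of_le (by positivity) hm₁
  have hm_pos : 0 < m := by exact_mod_cast hm_real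
  obtain ⟨n, hn⟩ : m ∣ W.lcm id := Finset.dvd_lcm (f := id) hm
  rw [hn, Nat.mul_div_cancel_left _ hm_pos] at hjm
  obtain ⟨k, hk⟩ : (q : ℤ) ∣ ((a * n : ℕ) : ℤ) - (s + j) := by
    rw [← ZMod.intCast_zmod_eq_zero_iff_dvd]
    push_cast at hjm ⊢
    rw [hjm, sub_self]
  have hkR : (a : ℝ) * n = s + j + q * k := by
    have : ((a : ℝ) * n - (s + j)) = q * k := by exact_mod_cast hk
    linarith
  have hdist := abs_le.mp (abs_div_sub_midpoint_le t hL (by norm_num) hm₁ hm₂)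
  have hxm : x = (k + (((s : ℝ) + j) / q + t / m)) * m := by
    have hnR : ((W.lcm id : ℕ) : ℝ) = m * n := by exact_mod_cast hn
    have hx : x = t + (a : ℝ) * n / q * m := by
      rw [ht_def, hnR]
      ring
    rw [hx, hkR]
    field_simp
    ring
  have hj₁R : (1 : ℝ) ≤ j := by exact_mod_cast hj₁
  have hj₂R : (j : ℝ) ≤ d + 1 := by exact_mod_cast hj₂
  have hsR : (s : ℝ) = ⌈(q : ℝ) * (h - c)⌉ - 1 := by
    rw [hs_def]
    push_cast
    ring
  have hlow : h - c ≤ ((s : ℝ) + j) / q := by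
    rw [le_div_iff₀ hq']
    linarith [Int.le_ceil ((q : ℝ) * (h - c))]
  have hupp : ((s : ℝ) + j) / q < h - c + (d + 1) / q := by
    have hsplit : h - c + ((d : ℝ) + 1) / q = (q * (h - c) + (d + 1)) / q := by field_simp
    rw [hsplit, div_lt_div_iff_of_pos_right hq']
    linarith [Int.ceil_lt_add_one ((q : ℝ) * (h - c))]
  have hρ' : ((d : ℝ) + 1) / q = 1 / 10 - 2 * ρ := by
    rw [hρ_def]
    field_simp
    ring
  exact notMem_Bad_of_eq hm_pos k hxm (by linarith) (by linarith) (by norm_num)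
    (Set.mem_iInter₂.mp hxW m hm)
end

section
/- Let n be an integer with 0 ≤ n ≤ 3997 and let K = (9/10)ⁿ · exp(524). Then there exists a positive integer κ such that: κ is squarefree; 3 divides κ; κ/3 is divisible only by primes q ≡ 5 (mod 6) with q > 167; and (263/265)·K^{1/3}/10^{11} ≤ κ ≤ (292/290)·K^{1/3}/10^{11}. -/
/-- The primes `q ≡ 5 (mod 6)` with `167 < q ≤ 443`. -/
def smallPrimes : List ℕ :=
  [173, 179, 191, 197, 227, 233, 239, 251, 257, 263, 269, 281, 293, 311, 317, 347, 353, 359, 383,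
    389, 401, 419, 431, 443]

/-- Primes `q ≡ 5 (mod 6)`, each at most `7738 / 7627` times its predecessor, where
`7738 / 7627 = (292 / 290) / (263 / 265)`. -/
def largePrimes : List ℕ :=
  [2591, 2621, 2657, 2693, 2729, 2753, 2789, 2819, 2843, 2879, 2909, 2939, 2969, 3011, 3041, 3083,
    3119, 3137, 3167, 3209, 3251, 3257, 3299, 3347, 3389, 3413, 3461, 3491, 3539, 3581, 3623,
    3671, 3719, 3767, 3821, 3863, 3917, 3947, 4001, 4049, 4091, 4139, 4157, 4217, 4271, 4289,
    4349, 4409, 4463, 4523, 4583, 4649, 4703, 4751, 4817, 4877, 4943, 5009, 5081, 5153, 5189,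
    5261, 5333, 5399, 5477, 5531, 5591, 5669, 5741, 5813, 5897, 5981, 6053, 6131, 6203, 6287,
    6359, 6449, 6521, 6599, 6689, 6779, 6869, 6959, 7043, 7127, 7229, 7331, 7433, 7541, 7649,
    7757, 7853, 7949, 8039, 8147, 8243, 8297, 8387, 8501, 8609, 8699, 8819, 8933, 9059, 9173,
    9293, 9419, 9551, 9689, 9803, 9941, 10079, 10223, 10343, 10487, 10631, 10781, 10937, 11093,
    11243, 11399, 11549, 11717, 11867, 12011, 12161, 12329, 12503, 12671, 12821, 13007, 13187,
    13367, 13553, 13721, 13913, 14087, 14249, 14447, 14657, 14867, 15083, 15299, 15497, 15683,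
    15887, 16103, 16319, 16553, 16787, 17027, 17231, 17477, 17729, 17987, 18233, 18461, 18719,
    18959, 19211, 19469, 19751, 20021, 20297, 20549, 20807, 21107, 21407, 21713, 22013, 22307,
    22619, 22943, 23201, 23537, 23879, 24203, 24551, 24851, 25169, 25523, 25889, 26261, 26633,
    27017, 27407, 27803, 28181, 28571, 28979, 29399, 29819, 30203, 30593, 31019, 31469, 31907,
    32369, 32831, 33287, 33767, 34253, 34739, 35201, 35603, 36107, 36629, 37139, 37649, 38189,
    38729, 39251, 39821, 40361, 40883, 41453, 42023, 42611, 43223, 43793, 44417, 45053, 45707,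
    46349, 46997, 47657, 48341, 49043, 49739, 50459, 51137, 51869, 52583, 53327, 54101, 54881,
    55673, 56477, 57287, 58109, 58943, 59771, 60623, 61493, 62351, 63197, 64109, 65033, 65963,
    66863, 67829, 68813, 69809, 70823, 71849, 72893, 73943, 75017, 76103, 77201, 78317, 79451,
    80603, 81773, 82913, 84089, 85259, 86477, 87719, 88937, 90227, 91529, 92861, 94169, 95531,
    96911, 98321, 99719, 101159, 102611, 104087, 105563, 107099, 108587, 110129, 111731, 113357,
    115001, 116663, 118343, 120047, 121787, 123551, 125339, 127163, 129011, 130859, 132761,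
    134681, 136607, 138587, 140603, 142619, 144671, 146681, 148793, 150929, 153113, 155333,
    157571, 159857, 162143, 164477, 166853, 169259, 171719, 174197, 176711, 179261, 181787,
    184409, 187091, 189797, 192557, 195359, 198197, 201011, 203921, 206879, 209861, 212909,
    215981, 219119, 222293, 225527, 228797, 232109, 235439, 238859, 242309, 245789, 249341,
    252911, 256589, 260231, 263957, 267797, 271637, 275579, 279557, 283607, 287681, 291857,
    296099, 300347, 304709, 309137, 313619, 318179, 322781, 327473, 332219, 337049, 341951,
    346877, 351887, 356999, 362177, 367427, 372773, 378179, 383681, 389231, 394829, 400559,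
    406361, 412253, 418199, 424271, 430433, 436673, 442997, 449441, 455969, 462569, 469283,
    476111, 483017, 490031, 497153, 504377, 511703, 519131, 526679, 534341, 542117, 549977,
    557981, 566057, 574289, 582623, 591089, 599681, 608393, 617237, 626207, 635309, 644549,
    653927, 663437, 673091, 682811, 692729, 702809, 713021, 723353, 733871, 744539, 755357,
    766313, 777437, 788687, 800159, 811799, 823601, 835559, 847703, 860009, 872477, 885161,
    898019, 911087, 924323, 937751, 951389, 965201, 979229, 993479, 1007933, 1022591, 1037471,
    1052567, 1067879, 1083377, 1099139, 1115117, 1131341, 1147793]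

theorem Nat.prime_of_coprime_factorial {p n : ℕ} (hn : n < p) (hp : p < (n + 1) ^ 2)
    (h : p.Coprime n.factorial) : p.Prime := by
  rcases Nat.lt_or_ge 1 p with hp1 | hp1
  · by_contra hnp
    have hsq := Nat.minFac_sq_le_self (by lia) hnp
    have hle : p.minFac ≤ n := Nat.lt_succ_iff.mp (lt_of_pow_lt_pow_left₀ 2 (by lia) (by lia))
    exact Nat.Prime.not_coprime_iff_dvd.mpr
      ⟨p.minFac, Nat.minFac_prime hp1.ne', p.minFac_dvd, Nat.dvd_factorial p.minFac_pos hle⟩ h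
  · obtain rfl : n = 0 := by lia
    lia

theorem Nat.prime_of_mem_of_coprime_factorial {l : List ℕ} {n : ℕ}
    (hl : ∀ p ∈ l, n < p ∧ p < (n + 1) ^ 2) (h : l.prod.Coprime n.factorial) {p : ℕ}
    (hp : p ∈ l) : p.Prime :=
  Nat.prime_of_coprime_factorial (hl p hp).1 (hl p hp).2
    (h.coprime_dvd_left (List.dvd_prod hp))

theorem prime_of_mem_smallPrimes {p : ℕ} (hp : p ∈ smallPrimes) : p.Prime :=
  Nat.prime_of_mem_of_coprime_factorial (n := 21) (by decide +kernel) (by decide +kernel) hp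

theorem prime_of_mem_largePrimes {p : ℕ} (hp : p ∈ largePrimes) : p.Prime :=
  Nat.prime_of_mem_of_coprime_factorial (n := 1100) (by decide +kernel) (by decide +kernel) hp

theorem mem_smallPrimes_bounds : ∀ p ∈ smallPrimes, p % 6 = 5 ∧ 167 < p ∧ p ≤ 443 := by
  decide +kernel

theorem mem_largePrimes_bounds : ∀ p ∈ largePrimes, p % 6 = 5 ∧ 443 < p := by
  decide +kernel

theorem Nat.exists_mem_eq_of_prime_dvd_prod {l : List ℕ} (hl : ∀ p ∈ l, p.Prime) {q : ℕ}
    (hq : q.Prime) (h : q ∣ l.prod) : q ∈ l := by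
  obtain ⟨a, ha, hqa⟩ := (Prime.dvd_prod_iff hq.prime).mp h
  rwa [(Nat.prime_dvd_prime_iff_eq hq (hl a ha)).mp hqa]

theorem Nat.squarefree_prod_of_nodup {l : List ℕ} (hl : ∀ p ∈ l, p.Prime) (hd : l.Nodup) :
    Squarefree l.prod := by
  induction l with
  | nil => simp
  | cons a l ih =>
    rw [List.nodup_cons] at hd
    have ha := hl a (by simp)
    have hl' : ∀ p ∈ l, p.Prime := fun p hp => hl p (by simp [hp])
    rw [List.prod_cons, Nat.squarefree_mul_iff]
    exact ⟨(Nat.Prime.coprime_iff_not_dvd ha).mpr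
      fun h => hd.1 (Nat.exists_mem_eq_of_prime_dvd_prod hl' ha h), ha.squarefree, ih hl' hd.2⟩

theorem exists_le_le_of_ratio_le {f : ℕ → ℝ} {N : ℕ} {r lo hi : ℝ} (hr : 0 ≤ r)
    (hf : ∀ k < N, f (k + 1) ≤ r * f k) (h0 : f 0 ≤ hi) (hN : lo ≤ f N) (h : r * lo ≤ hi) :
    ∃ k ≤ N, lo ≤ f k ∧ f k ≤ hi := by
  induction N with
  | zero => exact ⟨0, le_rfl, hN, h0⟩
  | succ N ih =>
    rcases le_or_gt lo (f N) with hlo | hlo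
    · obtain ⟨k, hk, hk'⟩ := ih (fun k hk => hf k (by lia)) hlo
      exact ⟨k, by lia, hk'⟩
    · exact ⟨N + 1, le_rfl, hN,
        (hf N (by lia)).trans ((mul_le_mul_of_nonneg_left hlo.le hr).trans h)⟩

theorem exists_mem_largePrimes {lo hi : ℝ} (h : 7738 / 7627 * lo ≤ hi) (h0 : 2591 ≤ hi)
    (hN : lo ≤ 1147793) : ∃ p ∈ largePrimes, lo ≤ p ∧ (p : ℝ) ≤ hi := by
  have hlen : largePrimes.length = 448 + 1 := by decide +kernel
  have hratio : ∀ k < 448,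
      7627 * largePrimes.getD (k + 1) 0 ≤ 7738 * largePrimes.getD k 0 := by decide +kernel
  have hfirst : largePrimes.getD 0 0 = 2591 := by decide +kernel
  have hlast : largePrimes.getD 448 0 = 1147793 := by decide +kernel
  obtain ⟨k, hk, hk'⟩ := exists_le_le_of_ratio_le (f := fun k => (largePrimes.getD k 0 : ℝ))
    (N := 448) (r := 7738 / 7627) (by norm_num)
    (fun k hk => by
      have : (7627 : ℝ) * largePrimes.getD (k + 1) 0 ≤ 7738 * largePrimes.getD k 0 := by
        exact_mod_cast hratio k hk
      linarith) (by rw [hfirst]; exact_mod_cast h0) (by rw [hlast]; exact_mod_cast hN) h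
  refine ⟨_, ?_, hk'⟩
  rw [List.getD_eq_getElem _ _ (by lia)]
  exact List.getElem_mem _

theorem exists_take_smallPrimes {lo hi : ℝ} (h : 443 * lo ≤ hi) (h0 : 1 ≤ hi)
    (hN : lo ≤ 10 ^ 59) :
    ∃ k, lo ≤ (smallPrimes.take k).prod ∧ ((smallPrimes.take k).prod : ℝ) ≤ hi := by
  have hratio : ∀ k < 24,
      (smallPrimes.take (k + 1)).prod ≤ 443 * (smallPrimes.take k).prod := by decide +kernel
  have hlast : 10 ^ 59 ≤ (smallPrimes.take 24).prod := by decide +kernel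
  obtain ⟨k, -, hk⟩ := exists_le_le_of_ratio_le
    (f := fun k => ((smallPrimes.take k).prod : ℝ)) (N := 24) (r := 443) (by norm_num)
    (fun k hk => by exact_mod_cast hratio k hk) (by simpa using h0)
    (hN.trans (by exact_mod_cast hlast)) h
  exact ⟨k, hk⟩

theorem exists_squarefree_of_ratio_le {lo hi : ℝ} (h : 7738 / 7627 * lo ≤ hi) (h0 : 2591 ≤ hi)
    (hN : lo ≤ 10 ^ 65) :
    ∃ m : ℕ, Squarefree m ∧ (∀ p : ℕ, p.Prime → p ∣ m → p % 6 = 5 ∧ 167 < p) ∧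
      lo ≤ m ∧ (m : ℝ) ≤ hi := by
  obtain ⟨k, hk₁, hk₂⟩ := exists_take_smallPrimes (lo := lo / 1147793) (hi := hi / 2591)
    (by linarith) (by linarith) (by linarith)
  set s := smallPrimes.take k
  have hs : ∀ p ∈ s, p ∈ smallPrimes := fun p hp => List.mem_of_mem_take hp
  have hM : (0 : ℝ) < s.prod := by
    exact_mod_cast List.prod_pos fun p hp => (prime_of_mem_smallPrimes (hs p hp)).pos
  obtain ⟨p, hp, hp₁, hp₂⟩ := exists_mem_largePrimes (lo := lo / s.prod) (hi := hi / s.prod)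
    (by rw [← mul_div_assoc]; gcongr) (by rw [le_div_iff₀ hM]; linarith)
    (by rw [div_le_iff₀ hM]; linarith)
  have hprime : ∀ q ∈ p :: s, q.Prime := by
    rintro q (_ | ⟨_, hq⟩)
    exacts [prime_of_mem_largePrimes hp, prime_of_mem_smallPrimes (hs q hq)]
  have hnodup : (p :: s).Nodup := by
    have hd : smallPrimes.Nodup := by decide +kernel
    refine List.nodup_cons.mpr ⟨fun hps => ?_, hd.sublist (List.take_sublist _ _)⟩
    have h₁ := mem_smallPrimes_bounds p (hs p hps)
    have h₂ := mem_largePrimes_bounds p hp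
    lia
  refine ⟨(p :: s).prod, Nat.squarefree_prod_of_nodup hprime hnodup, fun q hq hqd => ?_, ?_, ?_⟩
  · rcases List.mem_cons.mp (Nat.exists_mem_eq_of_prime_dvd_prod hprime hq hqd) with rfl | hqs
    · have := mem_largePrimes_bounds q hp
      lia
    · have := mem_smallPrimes_bounds q (hs q hqs)
      lia
  · rw [List.prod_cons, Nat.cast_mul]
    exact (div_le_iff₀ hM).mp hp₁
  · rw [List.prod_cons, Nat.cast_mul]
    exact (le_div_iff₀ hM).mp hp₂

set_option exponentiation.threshold 4000 in
theorem pow_le_nine_tenths_pow_mul_exp {n : ℕ} (hn : n ≤ 3997) :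
    (772 * 10 ^ 12 : ℝ) ^ 3 ≤ (9 / 10 : ℝ) ^ n * Real.exp 524 := by
  have hexp : Real.exp 524 = Real.exp 1 ^ 524 := by rw [← Real.exp_nat_mul]; norm_num
  calc (772 * 10 ^ 12 : ℝ) ^ 3 ≤ (9 / 10) ^ 3997 * 2.7182818283 ^ 524 := by norm_num
    _ ≤ (9 / 10 : ℝ) ^ n * Real.exp 524 := by
      rw [hexp]
      gcongr ?_ * ?_
      · exact pow_le_pow_of_le_one (by norm_num) (by norm_num) hn
      · exact pow_le_pow_left₀ (by norm_num) Real.exp_one_gt_d9.le _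

set_option exponentiation.threshold 600 in
theorem nine_tenths_pow_mul_exp_le_pow (n : ℕ) :
    (9 / 10 : ℝ) ^ n * Real.exp 524 ≤ (10 ^ 76) ^ 3 := by
  have hexp : Real.exp 524 = Real.exp 1 ^ 524 := by rw [← Real.exp_nat_mul]; norm_num
  calc (9 / 10 : ℝ) ^ n * Real.exp 524 ≤ 1 * 2.7182818286 ^ 524 := by
        rw [hexp]
        gcongr ?_ * ?_
        · exact pow_le_one₀ (by norm_num) (by norm_num)
        · exact pow_le_pow_left₀ (by positivity) Real.exp_one_lt_d9.le _
    _ ≤ (10 ^ 76) ^ 3 := by norm_num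

/-- For each `0 ≤ n ≤ 3997` and `K = (9/10)ⁿ·exp(524)` there is a squarefree
positive integer `κ`, divisible by 3, with `κ/3` divisible only by primes
`q ≡ 5 (mod 6)` exceeding 167, lying in the interval
`[(263/265)·K^{1/3}/10¹¹, (292/290)·K^{1/3}/10¹¹]`. -/
theorem exists_kappa (n : ℕ) (hn : n ≤ 3997) :
    ∃ κ : ℕ, 0 < κ ∧ Squarefree κ ∧ 3 ∣ κ ∧
      (∀ p : ℕ, p.Prime → p ∣ κ / 3 → p % 6 = 5 ∧ 167 < p) ∧
      (263 / 265 : ℝ) * ((9 / 10 : ℝ) ^ n * Real.exp 524) ^ ((1 : ℝ) / 3) / 10 ^ 11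
          ≤ (κ : ℝ) ∧
      (κ : ℝ) ≤
        (292 / 290 : ℝ) * ((9 / 10 : ℝ) ^ n * Real.exp 524) ^ ((1 : ℝ) / 3) / 10 ^ 11 := by
  set K := (9 / 10 : ℝ) ^ n * Real.exp 524
  have hK : 0 ≤ K := by positivity
  have hX : (K ^ ((1 : ℝ) / 3)) ^ 3 = K := by
    rw [← Real.rpow_mul_natCast hK]
    norm_num
  set X := K ^ ((1 : ℝ) / 3)
  have hX0 : 0 ≤ X := by positivity
  have hlow : 772 * 10 ^ 12 ≤ X :=
    le_of_pow_le_pow_left₀ (n := 3) (by norm_num) hX0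
      (hX ▸ pow_le_nine_tenths_pow_mul_exp hn)
  have hupp : X ≤ 10 ^ 76 :=
    le_of_pow_le_pow_left₀ (n := 3) (by norm_num) (by positivity)
      (hX ▸ nine_tenths_pow_mul_exp_le_pow n)
  obtain ⟨m, hm, hmp, hlo, hhi⟩ := exists_squarefree_of_ratio_le
    (lo := 263 / 265 * X / 10 ^ 11 / 3) (hi := 292 / 290 * X / 10 ^ 11 / 3)
    (by linarith) (by linarith) (by linarith)
  have h3 : Nat.Coprime 3 m := by
    refine (Nat.Prime.coprime_iff_not_dvd Nat.prime_three).mpr fun h => ?_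
    have := hmp 3 Nat.prime_three h
    lia
  refine ⟨3 * m, by have := hm.ne_zero; lia,
    Nat.squarefree_mul_iff.mpr ⟨h3, Nat.prime_three.squarefree, hm⟩, dvd_mul_right _ _, ?_, ?_, ?_⟩
  · rwa [Nat.mul_div_cancel_left m (by norm_num)]
  · push_cast
    linarith
  · push_cast
    linarith
end
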